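/- Let x = (α,β,A,B) ∈ M_ℤ be nonzero of rank 1, i.e. αA − B# = 0, βB − A# = 0, and (αβ − (A,B))C + ABC + CBA = 0 for all C ∈ J_ℤ. Then there exists g ∈ G_ℤ with g(x) = (d, 0, 0, 0), where d is the gcd of the 20 integer coordinates of x (the entries α, β and the matrix entries of A and B). Moreover, for positive integers k, k', if some g ∈ G_ℤ maps (k,0,0,0) to (k',0,0,0) then k = k'. -/

import Mathlib

open Matrix

namespace FreudenthalZ

/-- The integral cubic Jordan algebra `J_ℤ = M₃(ℤ)`. -/
abbrev MatZ := Matrix (Fin 3) (Fin 3) ℤ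

/-- The trace bilinear form `(A, B) = tr(A·B)`. -/
def tb (A B : MatZ) : ℤ := (A * B).trace

/-- The Freudenthal cross product `A × B = (A+B)# − A# − B#` (adjoint = adjugate). -/
def cross (A B : MatZ) : MatZ := (A + B).adjugate - A.adjugate - B.adjugate

/-- The integral Freudenthal module `M_ℤ = ℤ ⊕ ℤ ⊕ J_ℤ ⊕ J_ℤ`, elements `(α, β, A, B)`. -/
abbrev MZ := ℤ × ℤ × MatZ × MatZ

/-- The quartic norm `q'(x) = ((A,B) − αβ)² − 4(A#,B#) + 4α·det A + 4β·det B`. -/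
def qz (x : MZ) : ℤ :=
  (tb x.2.2.1 x.2.2.2 - x.1 * x.2.1) ^ 2 - 4 * tb x.2.2.1.adjugate x.2.2.2.adjugate
    + 4 * x.1 * x.2.2.1.det + 4 * x.2.1 * x.2.2.2.det

/-- The symplectic form `{x, y} = αδ − βγ + (A,D) − (B,C)`. -/
def symp (x y : MZ) : ℤ :=
  x.1 * y.2.1 - x.2.1 * y.1 + tb x.2.2.1 y.2.2.2 - tb x.2.2.2 y.2.2.1

/-- Membership in the group `G_ℤ`: `ℤ`-linear automorphisms of `M_ℤ`
preserving the quartic norm `q'` and the symplectic form `{·,·}`. -/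
def InG (g : MZ → MZ) : Prop :=
  IsLinearMap ℤ g ∧ Function.Bijective g ∧
    (∀ x, qz (g x) = qz x) ∧ (∀ x y, symp (g x) (g y) = symp x y)

/-- `x` is projective: some `g ∈ G_ℤ` maps `x` to a diagonal reduced element
`(α, β, diag(a₁,a₂,a₃), 0)` (`α > 0`, `α ∣ β`, `α ∣ aᵢ`) satisfying the three gcd
conditions `gcd(α·aᵢ, α·β, aⱼ·a_k) = 1`. -/
def Projective (x : MZ) : Prop :=
  ∃ g : MZ → MZ, InG g ∧ ∃ α β a₁ a₂ a₃ : ℤ,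
    g x = (α, β, Matrix.diagonal ![a₁, a₂, a₃], 0) ∧
    0 < α ∧ α ∣ β ∧ α ∣ a₁ ∧ α ∣ a₂ ∧ α ∣ a₃ ∧
    Int.gcd (Int.gcd (α * a₁) (α * β)) (a₂ * a₃) = 1 ∧
    Int.gcd (Int.gcd (α * a₂) (α * β)) (a₃ * a₁) = 1 ∧
    Int.gcd (Int.gcd (α * a₃) (α * β)) (a₁ * a₂) = 1

end FreudenthalZ

open FreudenthalZ

namespace FreudenthalZ

/-- The rank `≤ 1` condition: `αA − B# = 0`, `βB − A# = 0`, and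
`(αβ − (A,B))C + ABC + CBA = 0` for all `C ∈ J_ℤ`. -/
def RankLeOne (x : MZ) : Prop :=
  x.1 • x.2.2.1 - x.2.2.2.adjugate = 0 ∧
  x.2.1 • x.2.2.2 - x.2.2.1.adjugate = 0 ∧
  ∀ C : MatZ,
    (x.1 * x.2.1 - tb x.2.2.1 x.2.2.2) • C
      + x.2.2.1 * x.2.2.2 * C + C * x.2.2.2 * x.2.2.1 = 0

/-- The gcd of the 20 integer coordinates of `x = (α, β, A, B)` (the entries `α`, `β`
and the matrix entries of `A` and `B`), as a nonnegative integer. -/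
def gcd20 (x : MZ) : ℤ :=
  gcd x.1 (gcd x.2.1
    (gcd (Finset.univ.gcd fun p : Fin 3 × Fin 3 => x.2.2.1 p.1 p.2)
         (Finset.univ.gcd fun p : Fin 3 × Fin 3 => x.2.2.2 p.1 p.2)))

end FreudenthalZ

namespace FreudenthalZ

theorem adjE (A : MatZ) :
    A.adjugate 0 0 = A 1 1 * A 2 2 - A 1 2 * A 2 1 ∧
    A.adjugate 0 1 = -(A 0 1 * A 2 2) + A 0 2 * A 2 1 ∧
    A.adjugate 0 2 = A 0 1 * A 1 2 - A 0 2 * A 1 1 ∧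
    A.adjugate 1 0 = -(A 1 0 * A 2 2) + A 1 2 * A 2 0 ∧
    A.adjugate 1 1 = A 0 0 * A 2 2 - A 0 2 * A 2 0 ∧
    A.adjugate 1 2 = -(A 0 0 * A 1 2) + A 0 2 * A 1 0 ∧
    A.adjugate 2 0 = A 1 0 * A 2 1 - A 1 1 * A 2 0 ∧
    A.adjugate 2 1 = -(A 0 0 * A 2 1) + A 0 1 * A 2 0 ∧
    A.adjugate 2 2 = A 0 0 * A 1 1 - A 0 1 * A 1 0 := by
  simp [Matrix.adjugate_fin_three]

theorem mulE (A B : MatZ) (i j : Fin 3) :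
    (A * B) i j = A i 0 * B 0 j + A i 1 * B 1 j + A i 2 * B 2 j := by
  simp [Matrix.mul_apply, Fin.sum_univ_three]

theorem tbE (A B : MatZ) : tb A B =
    A 0 0 * B 0 0 + A 0 1 * B 1 0 + A 0 2 * B 2 0 +
    (A 1 0 * B 0 1 + A 1 1 * B 1 1 + A 1 2 * B 2 1) +
    (A 2 0 * B 0 2 + A 2 1 * B 1 2 + A 2 2 * B 2 2) := by
  simp [tb, Matrix.trace_fin_three, mulE]

theorem extZ {A B : MatZ} (h00 : A 0 0 = B 0 0) (h01 : A 0 1 = B 0 1) (h02 : A 0 2 = B 0 2)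
    (h10 : A 1 0 = B 1 0) (h11 : A 1 1 = B 1 1) (h12 : A 1 2 = B 1 2)
    (h20 : A 2 0 = B 2 0) (h21 : A 2 1 = B 2 1) (h22 : A 2 2 = B 2 2) : A = B := by
  ext i j; fin_cases i <;> fin_cases j <;> assumption

/-- A convenient reformulation of the rank condition. -/
def Rk (x : MZ) : Prop :=
  x.2.2.2.adjugate = x.1 • x.2.2.1 ∧ x.2.2.1.adjugate = x.2.1 • x.2.2.2 ∧
  x.2.2.1 * x.2.2.2 = (x.1 * x.2.1) • (1 : MatZ) ∧
  x.2.2.2 * x.2.2.1 = (x.1 * x.2.1) • (1 : MatZ)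

theorem rk_of_rank (x : MZ) (h : RankLeOne x) : Rk x := by
  obtain ⟨a, b, A, B⟩ := x
  obtain ⟨h1, h2, h3⟩ := h
  simp only at h1 h2 h3
  refine ⟨(sub_eq_zero.mp h1).symm, (sub_eq_zero.mp h2).symm, ?_⟩
  simp only
  have htr : tb A B = (A * B) 0 0 + (A * B) 1 1 + (A * B) 2 2 := by
    simp [tb, Matrix.trace_fin_three]
  have htr2 : tb A B = (B * A) 0 0 + (B * A) 1 1 + (B * A) 2 2 := by
    rw [tb, Matrix.trace_mul_comm]; simp [Matrix.trace_fin_three]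
  simp only [Matrix.mul_assoc _ B A] at h3
  generalize A * B = P at *
  generalize B * A = Q at *
  generalize tb A B = s at *
  have e : ∀ i j k l : Fin 3, _ := fun i j k l => congrFun (congrFun (h3 (Matrix.single i j 1)) k) l
  have e00 := e 0 0
  have e01 := e 0 1
  have e02 := e 0 2
  have e10 := e 1 0
  have e20 := e 2 0
  have e11 := e 1 1
  have e22 := e 2 2
  clear e h3
  simp [Fin.forall_fin_succ, Matrix.mul_apply, Fin.sum_univ_three, Matrix.single_apply] at e00 e01 e02 e10 e20 e11 e22
  constructor
  · ext i j
    fin_cases i <;> fin_cases j <;> simp [Matrix.one_apply] <;> omega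
  · ext i j
    fin_cases i <;> fin_cases j <;> simp [Matrix.one_apply] <;> omega

/-- Elementary translation. -/
def phi (D : MatZ) (x : MZ) : MZ :=
  (x.1, x.2.1 + tb x.2.2.1 D, x.2.2.1 + cross x.2.2.2 D, x.2.2.2 + x.1 • D)

/-- Duality. -/
def swp (x : MZ) : MZ := (-x.2.1, x.1, -x.2.2.2, x.2.2.1)

def Good (g : MZ → MZ) : Prop := InG g ∧ ∀ x, Rk x → Rk (g x)

theorem InG.comp {f g : MZ → MZ} (hf : InG f) (hg : InG g) : InG (f ∘ g) := by
  obtain ⟨a1, a2, a3, a4⟩ := hf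
  obtain ⟨b1, b2, b3, b4⟩ := hg
  refine ⟨⟨fun x y => ?_, fun c x => ?_⟩, a2.comp b2, fun x => ?_, fun x y => ?_⟩
  · simp [b1.map_add, a1.map_add]
  · simp [-zsmul_eq_mul, b1.map_smul, a1.map_smul]
  · simp [a3, b3]
  · simp [a4, b4]

theorem Good.comp {f g : MZ → MZ} (hf : Good f) (hg : Good g) : Good (f ∘ g) :=
  ⟨hf.1.comp hg.1, fun x hx => hf.2 _ (hg.2 _ hx)⟩

theorem good_id : Good id :=
  ⟨⟨⟨fun _ _ => rfl, fun _ _ => rfl⟩, Function.bijective_id, fun _ => rfl, fun _ _ => rfl⟩,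
    fun _ h => h⟩

theorem inG_neg : InG (fun x => -x) := by
  refine ⟨⟨fun x y => neg_add x y, fun c x => (smul_neg c x).symm⟩, neg_involutive.bijective,
    fun x => ?_, fun x y => ?_⟩
  · obtain ⟨a, b, A, B⟩ := x
    simp [qz, tb, Matrix.det_fin_three, Matrix.adjugate_fin_three, Matrix.trace_fin_three,
      Matrix.mul_apply, Fin.sum_univ_three]
    ring
  · simp [symp, tb]

theorem good_swp : Good swp := by
  refine ⟨⟨⟨fun x y => ?_, fun c x => ?_⟩, ?_, fun x => ?_, fun x y => ?_⟩, fun x hx => ?_⟩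
  · simp [swp]; constructor <;> abel
  · simp [swp]
  · refine ⟨fun x y h => ?_, fun y => ⟨(y.2.1, -y.1, y.2.2.2, -y.2.2.1), ?_⟩⟩
    · simp [swp] at h
      ext1; exact h.2.1
      ext1; exact h.1
      ext1; exact h.2.2.2
      exact h.2.2.1
    · simp [swp]
  · obtain ⟨a, b, A, B⟩ := x
    simp [swp, qz, tb, Matrix.det_fin_three, Matrix.adjugate_fin_three, Matrix.trace_fin_three,
      Matrix.mul_apply, Fin.sum_univ_three]
    ring
  · simp [swp, symp, tbE]
    ring
  · obtain ⟨a, b, A, B⟩ := x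
    obtain ⟨h1, h2, h3, h4⟩ := hx
    simp only at h1 h2 h3 h4
    refine ⟨?_, ?_, ?_, ?_⟩
    · simp [swp, h2]
    · have : (-B).adjugate = B.adjugate := by
        ext i j; fin_cases i <;> fin_cases j <;> simp [Matrix.adjugate_fin_three]
      simp [swp, this, h1]
    · simp [swp, h4, mul_comm]
    · simp [swp, h3, mul_comm]

theorem cross_mul_left (B D : MatZ) :
    cross B D * B + B.adjugate * D = (tb B.adjugate D) • (1 : MatZ) := by
  apply extZ <;> simp [-zsmul_eq_mul, cross, tbE, mulE, adjE, Matrix.add_apply, Matrix.sub_apply, Matrix.neg_apply,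
    Matrix.smul_apply, Matrix.one_apply, smul_eq_mul] <;> ring

theorem mul_cross_left (B D : MatZ) :
    B * cross B D + D * B.adjugate = (tb B.adjugate D) • (1 : MatZ) := by
  apply extZ <;> simp [-zsmul_eq_mul, cross, tbE, mulE, adjE, Matrix.add_apply, Matrix.sub_apply, Matrix.neg_apply,
    Matrix.smul_apply, Matrix.one_apply, smul_eq_mul] <;> ring

theorem cross_comm (B D : MatZ) : cross B D = cross D B := by
  unfold cross; rw [add_comm]; abel

theorem cross_smul (B D : MatZ) (c : ℤ) : cross B (c • D) = c • cross B D := by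
  apply extZ <;> simp [-zsmul_eq_mul, cross, tbE, mulE, adjE, Matrix.add_apply, Matrix.sub_apply, Matrix.neg_apply,
    Matrix.smul_apply, Matrix.one_apply, smul_eq_mul] <;> ring

theorem adj_add (B D : MatZ) : (B + D).adjugate = B.adjugate + cross B D + D.adjugate := by
  unfold cross; abel

theorem cross_cross (A B D : MatZ) : cross A (cross B D) =
    tb A D • B + tb A B • D - B * A * D - D * A * B := by
  apply extZ <;> simp [-zsmul_eq_mul, cross, tbE, mulE, adjE, Matrix.add_apply, Matrix.sub_apply, Matrix.neg_apply,
    Matrix.smul_apply, Matrix.one_apply, smul_eq_mul] <;> ring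

theorem adj_cross (B D : MatZ) : (cross B D).adjugate + cross B.adjugate D.adjugate
    = tb B.adjugate D • D + tb D.adjugate B • B := by
  apply extZ <;> simp [-zsmul_eq_mul, cross, tbE, mulE, adjE, Matrix.add_apply, Matrix.sub_apply, Matrix.neg_apply,
    Matrix.smul_apply, Matrix.one_apply, smul_eq_mul] <;> ring


theorem rk_phi (D : MatZ) (hD : D.adjugate = 0) (x : MZ) (hx : Rk x) : Rk (phi D x) := by
  obtain ⟨a, b, A, B⟩ := x
  obtain ⟨h1, h2, h3, h4⟩ := hx
  simp only at h1 h2 h3 h4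
  have t1 : tb B.adjugate D = a * tb A D := by simp [-zsmul_eq_mul, h1, tb]
  have k1 := cross_mul_left B D
  have k2 := mul_cross_left B D
  have k3 := cross_mul_left D B
  have k4 := mul_cross_left D B
  have k5 := adj_cross B D
  have k6 := cross_cross A B D
  rw [cross_comm D B] at k3 k4
  have t2 : tb A B = 3 * (a * b) := by
    rw [tb, h3, Matrix.trace_smul, Matrix.trace_one, smul_eq_mul]; simp; ring
  have t0 : tb (0 : MatZ) B = 0 := by simp [-zsmul_eq_mul, tb]
  have c0 : cross (a • A) 0 = 0 := by simp [-zsmul_eq_mul, cross]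
  rw [t1, h1] at k1 k2
  rw [hD, t0] at k3 k4
  rw [hD, t1, t0, h1, c0] at k5
  rw [h4, Matrix.mul_assoc D A B, h3, t2] at k6
  simp only [Matrix.mul_smul, Matrix.smul_mul, Matrix.zero_mul, Matrix.mul_zero, zero_smul,
    add_zero, Matrix.one_mul, Matrix.mul_one] at k1 k2 k3 k4 k5 k6
  have k1' := eq_sub_of_add_eq k1
  have k2' := eq_sub_of_add_eq k2
  refine ⟨?_, ?_, ?_, ?_⟩
  · simp only [phi]
    rw [adj_add, cross_smul, Matrix.adjugate_smul, hD, h1]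
    simp [-zsmul_eq_mul]
  · simp only [phi]
    rw [adj_add, k5, k6, h2]
    module
  · simp only [phi]
    rw [Matrix.add_mul, Matrix.mul_add, Matrix.mul_add, Matrix.mul_smul, Matrix.mul_smul, k3, k1', h3]
    module
  · simp only [phi]
    rw [Matrix.add_mul, Matrix.mul_add, Matrix.mul_add, Matrix.smul_mul, Matrix.smul_mul, k4, k2', h4]
    module

theorem phi_linear (D : MatZ) : IsLinearMap ℤ (phi D) := by
  refine ⟨fun x y => ?_, fun c x => ?_⟩
  · have : cross (x.2.2.2 + y.2.2.2) D = cross x.2.2.2 D + cross y.2.2.2 D := by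
      apply extZ <;> simp [-zsmul_eq_mul, cross, tbE, mulE, adjE, Matrix.add_apply, Matrix.sub_apply, Matrix.neg_apply,
    Matrix.smul_apply, Matrix.one_apply, smul_eq_mul] <;> ring
    simp [-zsmul_eq_mul, phi, this, tb, Matrix.add_mul, add_smul]
    refine ⟨by ring, by abel, by abel⟩
  · have : cross (c • x.2.2.2) D = c • cross x.2.2.2 D := by
      rw [cross_comm, cross_smul, cross_comm]
    simp [-zsmul_eq_mul, phi, this, tb, mul_add, mul_smul]

theorem symp_phi (D : MatZ) (hD : D.adjugate = 0) (x y : MZ) :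
    symp (phi D x) (phi D y) = symp x y := by
  obtain ⟨a, b, A, B⟩ := x
  obtain ⟨c, d, C, E⟩ := y
  have h1 : tb (cross B D) E = tb B (cross E D) := by
    simp only [cross, tbE, mulE, adjE, Matrix.add_apply, Matrix.sub_apply, Matrix.neg_apply,
    Matrix.smul_apply, Matrix.one_apply, smul_eq_mul]; ring
  have h2 : ∀ B : MatZ, tb (cross B D) D = 0 := by
    intro B
    have : tb (cross B D) D = 2 * tb D.adjugate B := by
      simp only [cross, tbE, mulE, adjE, Matrix.add_apply, Matrix.sub_apply, Matrix.neg_apply,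
    Matrix.smul_apply, Matrix.one_apply, smul_eq_mul]; ring
    rw [this, hD]; simp [-zsmul_eq_mul, tb]
  have h3 : tb D (cross E D) = 0 := by
    rw [tb, Matrix.trace_mul_comm]; exact h2 E
  have h4 : tb D C = tb C D := by rw [tb, Matrix.trace_mul_comm]; rfl
  have l : ∀ X Y Z : MatZ, tb (X + Y) Z = tb X Z + tb Y Z := by
    intros; simp [-zsmul_eq_mul, tb, Matrix.add_mul]
  have r : ∀ X Y Z : MatZ, tb X (Y + Z) = tb X Y + tb X Z := by
    intros; simp [-zsmul_eq_mul, tb, Matrix.mul_add]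
  have ls : ∀ (c : ℤ) (X Y : MatZ), tb (c • X) Y = c * tb X Y := by
    intros; simp [-zsmul_eq_mul, tb]
  have rs : ∀ (c : ℤ) (X Y : MatZ), tb X (c • Y) = c * tb X Y := by
    intros; simp [-zsmul_eq_mul, tb]
  simp only [symp, phi, l, r, ls, rs, h1, h2, h3, h4]
  ring

theorem phi_neg_phi (D : MatZ) (hD : D.adjugate = 0) (x : MZ) : phi (-D) (phi D x) = x := by
  obtain ⟨a, b, A, B⟩ := x
  have h2 : tb (cross B D) D = 0 := by
    have : tb (cross B D) D = 2 * tb D.adjugate B := by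
      simp only [cross, tbE, mulE, adjE, Matrix.add_apply, Matrix.sub_apply, Matrix.neg_apply,
    Matrix.smul_apply, Matrix.one_apply, smul_eq_mul]; ring
    rw [this, hD]; simp [-zsmul_eq_mul, tb]
  have h3 : cross (B + a • D) (-D) = - cross B D - (2 * a) • D.adjugate := by
    apply extZ <;> simp [-zsmul_eq_mul, cross, tbE, mulE, adjE, Matrix.add_apply, Matrix.sub_apply, Matrix.neg_apply,
    Matrix.smul_apply, Matrix.one_apply, smul_eq_mul] <;> ring
  have h4 : tb (A + cross B D) (-D) = - tb A D - tb (cross B D) D := by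
    simp [-zsmul_eq_mul, tb, Matrix.add_mul]; ring
  simp [-zsmul_eq_mul, phi, h3, h4, h2, hD]

theorem adj_single (i j : Fin 3) (t : ℤ) : (Matrix.single i j t).adjugate = 0 := by
  ext k l
  fin_cases i <;> fin_cases j <;> fin_cases k <;> fin_cases l <;>
    simp [-zsmul_eq_mul, Matrix.adjugate_fin_three, Matrix.single_apply]

theorem qz_phi (i j : Fin 3) (t : ℤ) (x : MZ) :
    qz (phi (Matrix.single i j t) x) = qz x := by
  obtain ⟨a, b, A, B⟩ := x
  fin_cases i <;> fin_cases j <;>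
  · simp [-zsmul_eq_mul, qz, phi, cross, tb, Matrix.det_fin_three, Matrix.adjugate_fin_three,
      Matrix.trace_fin_three, Matrix.mul_apply, Fin.sum_univ_three, Matrix.single_apply]
    ring

theorem good_phi (i j : Fin 3) (t : ℤ) : Good (phi (Matrix.single i j t)) := by
  have hD := adj_single i j t
  refine ⟨⟨phi_linear _, ⟨?_, ?_⟩, qz_phi i j t, symp_phi _ hD⟩, rk_phi _ hD⟩
  · exact Function.LeftInverse.injective (phi_neg_phi _ hD)
  · have hD' : (-Matrix.single i j t).adjugate = 0 := by
      have := adj_single i j (-t)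
      rwa [← Matrix.single_neg] at this
    intro y
    refine ⟨phi (-Matrix.single i j t) y, ?_⟩
    have := phi_neg_phi _ hD' y
    rwa [neg_neg] at this

theorem clear_B (x : MZ) (D : MatZ) (s : Finset (Fin 3 × Fin 3)) :
    ∃ g, Good g ∧ (g x).1 = x.1 ∧
      (g x).2.2.2 = x.2.2.2 + x.1 • ∑ p ∈ s, Matrix.single p.1 p.2 (D p.1 p.2) := by
  classical
  induction s using Finset.induction_on with
  | empty => exact ⟨id, good_id, rfl, by simp⟩
  | insert p s hp ih =>
    obtain ⟨g, hg, h1, h2⟩ := ih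
    refine ⟨phi (Matrix.single p.1 p.2 (D p.1 p.2)) ∘ g, (good_phi _ _ _).comp hg, ?_, ?_⟩
    · simp [-zsmul_eq_mul, phi, h1]
    · rw [Finset.sum_insert hp]
      simp only [phi, Function.comp, h1, h2, smul_add]
      abel

theorem exists_alpha (x : MZ) (hx : x ≠ 0) : ∃ g, Good g ∧ (g x).1 ≠ 0 := by
  by_cases ha : x.1 = 0
  swap
  · exact ⟨id, good_id, ha⟩
  by_cases hb : x.2.1 = 0
  swap
  · exact ⟨swp, good_swp, by simpa [-zsmul_eq_mul, swp] using hb⟩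
  by_cases hA : x.2.2.1 = 0
  · have hB : x.2.2.2 ≠ 0 := by
      intro hB
      apply hx
      ext1; exact ha
      ext1; exact hb
      ext1; exact hA
      exact hB
    obtain ⟨i, j, hij⟩ : ∃ i j, x.2.2.2 i j ≠ 0 := by
      by_contra! h
      exact hB (by ext i j; exact h i j)
    refine ⟨swp ∘ phi (Matrix.single j i 1) ∘ swp,
      good_swp.comp ((good_phi _ _ _).comp good_swp), ?_⟩
    simpa [-zsmul_eq_mul, swp, phi, tb, ha, Matrix.trace_mul_single] using hij
  · obtain ⟨i, j, hij⟩ : ∃ i j, x.2.2.1 i j ≠ 0 := by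
      by_contra! h
      exact hA (by ext i j; exact h i j)
    refine ⟨swp ∘ phi (Matrix.single j i 1), good_swp.comp (good_phi _ _ _), ?_⟩
    simpa [-zsmul_eq_mul, swp, phi, tb, hb, Matrix.trace_mul_single] using hij

theorem move_alpha (x : MZ) (i j : Fin 3) (t : ℤ) :
    ∃ g, Good g ∧ (g x).1 = -x.1 + t * x.2.2.2 i j := by
  refine ⟨swp ∘ phi (Matrix.single j i t) ∘ swp,
      good_swp.comp ((good_phi _ _ _).comp good_swp), ?_⟩
  simp [-zsmul_eq_mul, swp, phi, tb, Matrix.trace_mul_single]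
  ring

theorem reduce (n : ℕ) : ∀ x : MZ, Rk x → x.1 ≠ 0 → x.1.natAbs = n →
    ∃ g k, InG g ∧ g x = (k, 0, 0, 0) := by
  induction n using Nat.strong_induction_on with
  | _ n ih =>
    intro x hr hx hn
    by_cases hd : ∀ i j, x.1 ∣ x.2.2.2 i j
    · choose D hD using hd
      obtain ⟨g, hg, h1, h2⟩ := clear_B x (-(Matrix.of D)) Finset.univ
      refine ⟨g, x.1, hg.1, ?_⟩
      have hB : (g x).2.2.2 = 0 := by
        have hs := Matrix.matrix_eq_sum_single (-(Matrix.of D))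
        rw [h2, Fintype.sum_prod_type]
        simp only
        rw [← hs]
        ext i j
        simp [-zsmul_eq_mul, hD i j]
      obtain ⟨e1, e2, e3, e4⟩ := hg.2 x hr
      rw [hB, h1] at e1 e3
      have hA : (g x).2.2.1 = 0 := by
        simp [-zsmul_eq_mul] at e1
        exact (smul_eq_zero.mp e1.symm).resolve_left hx
      have hb : (g x).2.1 = 0 := by
        have := congrFun (congrFun e3 0) 0
        simpa [-zsmul_eq_mul, hx] using this
      ext1; exact h1
      ext1; exact hb
      ext1; exact hA
      exact hB
    · push Not at hd
      obtain ⟨i, j, hij⟩ := hd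
      set r := x.2.2.2 i j % x.1 with hrdef
      have hr0 : 0 < r := by
        have h0 := Int.emod_nonneg (x.2.2.2 i j) hx
        have h1 : r ≠ 0 := fun h => hij (Int.dvd_of_emod_eq_zero h)
        omega
      have hr1 : r < |x.1| := Int.emod_lt_abs _ hx
      have g1 := good_phi i j (-(x.2.2.2 i j / x.1))
      set y := phi (Matrix.single i j (-(x.2.2.2 i j / x.1))) x with hy
      have hy1 : y.1 = x.1 := rfl
      have hy2 : y.2.2.2 i j = r := by
        have := Int.emod_add_mul_ediv (x.2.2.2 i j) x.1
        simp [-zsmul_eq_mul, hy, phi]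
        linarith
      obtain ⟨g2, hg2, e2⟩ := move_alpha y i j (x.1 / r + 1)
      rw [hy1, hy2] at e2
      have m0 := Int.emod_nonneg x.1 hr0.ne'
      have m1 := Int.emod_lt_of_pos x.1 hr0
      have m2 := Int.emod_add_mul_ediv x.1 r
      have e3 : (g2 y).1 = r - x.1 % r := by rw [e2]; linarith
      have p1 : 0 < (g2 y).1 := by omega
      have p2 : (g2 y).1 ≤ r := by omega
      obtain ⟨g3, k, hg3, e4⟩ := ih (g2 y).1.natAbs (by rw [Int.abs_eq_natAbs] at hr1; omega) (g2 y)
        (hg2.2 _ (g1.2 _ hr)) p1.ne' rfl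
      exact ⟨g3 ∘ g2 ∘ _, k, hg3.comp (hg2.1.comp g1.1), e4⟩

theorem dvd_gcd20 (x : MZ) (c : ℤ) : c ∣ gcd20 x ↔ ∃ y : MZ, x = c • y := by
  have key : c ∣ gcd20 x ↔ c ∣ x.1 ∧ c ∣ x.2.1 ∧ (∀ i j, c ∣ x.2.2.1 i j) ∧
      (∀ i j, c ∣ x.2.2.2 i j) := by
    unfold gcd20
    rw [dvd_gcd_iff, dvd_gcd_iff, dvd_gcd_iff, Finset.dvd_gcd_iff, Finset.dvd_gcd_iff]
    simp
  rw [key]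
  constructor
  · rintro ⟨⟨a, ha⟩, ⟨b, hb⟩, hA, hB⟩
    choose A hA using hA
    choose B hB using hB
    refine ⟨(a, b, Matrix.of A, Matrix.of B), ?_⟩
    ext1
    · simpa [-zsmul_eq_mul] using ha
    ext1
    · simpa [-zsmul_eq_mul] using hb
    ext1
    · ext i j; simpa [-zsmul_eq_mul] using hA i j
    · ext i j; simpa [-zsmul_eq_mul] using hB i j
  · rintro ⟨y, rfl⟩
    simp [-zsmul_eq_mul]

theorem gcd20_nonneg (x : MZ) : 0 ≤ gcd20 x := by
  have : normalize (gcd20 x) = gcd20 x := by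
    unfold gcd20; exact normalize_gcd _ _
  rw [← this, ← Int.abs_eq_normalize]
  exact abs_nonneg _

theorem gcd20_inv {g : MZ → MZ} (hg : InG g) (x : MZ) : gcd20 (g x) = gcd20 x := by
  have h : ∀ c : ℤ, c ∣ gcd20 (g x) ↔ c ∣ gcd20 x := by
    intro c
    rw [dvd_gcd20, dvd_gcd20]
    constructor
    · rintro ⟨y, hy⟩
      obtain ⟨z, rfl⟩ := hg.2.1.2 y
      rw [← hg.1.map_smul] at hy
      exact ⟨z, hg.2.1.1 hy⟩
    · rintro ⟨y, rfl⟩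
      exact ⟨g y, hg.1.map_smul c y⟩
  exact Int.dvd_antisymm (gcd20_nonneg _) (gcd20_nonneg _) ((h _).1 dvd_rfl) ((h _).2 dvd_rfl)

theorem gcd20_std (k : ℤ) : gcd20 (k, 0, 0, 0) = |k| := by
  apply Int.dvd_antisymm (gcd20_nonneg _) (abs_nonneg _)
  · rw [dvd_abs]
    exact gcd_dvd_left _ _
  · rw [abs_dvd, dvd_gcd20]
    exact ⟨(1, 0, 0, 0), by simp [-zsmul_eq_mul]⟩

end FreudenthalZ

/-- **Orbits of rank-1 elements of `M_ℤ`**: every nonzero `x` of rank 1 can be brought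
by `G_ℤ` to `(d, 0, 0, 0)`, where `d = gcd` of the 20 coordinates of `x`; moreover
distinct such normal forms lie in distinct orbits. -/
theorem rank_one_orbits_Z :
    (∀ x : MZ, x ≠ 0 → RankLeOne x →
      ∃ g : MZ → MZ, InG g ∧ g x = (gcd20 x, 0, 0, 0)) ∧
    (∀ k k' : ℤ, 0 < k → 0 < k' →
      (∃ g : MZ → MZ, InG g ∧ g ((k, 0, 0, 0) : MZ) = (k', 0, 0, 0)) → k = k') := by
  constructor
  · intro x hx hr
    have hr' := rk_of_rank x hr
    obtain ⟨g1, hg1, h1⟩ := exists_alpha x hx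
    obtain ⟨g2, k, hg2, h2⟩ := reduce _ (g1 x) (hg1.2 x hr') h1 rfl
    have hG := hg2.comp hg1.1
    have e : (g2 ∘ g1) x = (k, 0, 0, 0) := h2
    have hk : gcd20 x = |k| := by rw [← gcd20_inv hG x, e, gcd20_std]
    rcases abs_choice k with h | h
    · exact ⟨_, hG, by rw [e, hk, h]⟩
    · refine ⟨_, inG_neg.comp hG, ?_⟩
      rw [Function.comp, e, hk, h]
      simp
  · rintro k k' hk hk' ⟨g, hg, e⟩
    have := gcd20_inv hg (k, 0, 0, 0)
    rw [e, gcd20_std, gcd20_std, abs_of_pos hk, abs_of_pos hk'] at this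
    exact this.symm
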